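/- Let μ, ν be probability measures on ℝ and let μ ⊳ ν denote their subordination distribution. Then on a common domain in ℂ⁺, φ_{μ⊳ν}(z) = φ_μ(F_ν(z)). Moreover, if μ ⊳ ν is ⊞-infinitely divisible and Φ[μ,ν] := B^{−1}[μ ⊳ ν], then z − F_{Φ[μ,ν]}(z) = φ_μ(F_ν(z)) and φ_μ = φ_{Φ[μ,ν], ν}, where φ_{~μ,μ} denotes the two-state Voiculescu transform. -/

import Mathlib

open MeasureTheory Complex

noncomputable section

/-- The Cauchy transform `G_μ(z) = ∫ 1/(z - x) dμ(x)` of a measure on `ℝ`. -/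
def cauchyG (μ : Measure ℝ) (z : ℂ) : ℂ := ∫ x : ℝ, (z - (x : ℂ))⁻¹ ∂μ

/-- The F-transform `F_μ = 1/G_μ`. -/
def Ftr (μ : Measure ℝ) (z : ℂ) : ℂ := (cauchyG μ z)⁻¹

/-- The open upper half-plane `ℂ⁺`. -/
def UHP : Set ℂ := {z : ℂ | 0 < z.im}

/-- The truncated cone `Γ_{α,M} = {z ∈ ℂ⁺ : |Re z| < α · Im z, Im z > M}`. -/
def tcone (α M : ℝ) : Set ℂ := {z : ℂ | |z.re| < α * z.im ∧ M < z.im}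

/-- `φ` is a Voiculescu transform of `μ`: `φ(F_μ(z)) + F_μ(z) = z` on some truncated cone. -/
def IsVT (μ : Measure ℝ) (φ : ℂ → ℂ) : Prop :=
  ∃ α M : ℝ, 0 < α ∧ 0 < M ∧ ∀ z ∈ tcone α M, φ (Ftr μ z) + Ftr μ z = z

/-- `ψ` is a two-state Voiculescu transform of the pair `(μt, μ)`:
`ψ(F_μ(z)) + F_{μt}(z) = z` on some truncated cone. -/
def IsTwoStateVT (μt μ : Measure ℝ) (ψ : ℂ → ℂ) : Prop :=
  ∃ α M : ℝ, 0 < α ∧ 0 < M ∧ ∀ z ∈ tcone α M, ψ (Ftr μ z) + Ftr μt z = z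

/-- `μ` is freely infinitely divisible: some Voiculescu transform `φ` of `μ` is such that
`t·φ` is a Voiculescu transform of a probability measure for every `t ≥ 0`. -/
def IsFID (μ : Measure ℝ) : Prop :=
  ∃ φ : ℂ → ℂ, IsVT μ φ ∧ ∀ t : ℝ, 0 ≤ t →
    ∃ ν : Measure ℝ, IsProbabilityMeasure ν ∧ IsVT ν (fun z => (t : ℂ) * φ z)

/-- The semicircular distribution with mean `β` and variance `γ` (Dirac mass at `β` for `γ = 0`). -/
def semicircle (β γ : ℝ) : Measure ℝ :=
  if γ = 0 then Measure.dirac β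
  else volume.withDensity
    (fun x => ENNReal.ofReal ((2 * Real.pi * γ)⁻¹ * Real.sqrt (4 * γ - (x - β) ^ 2)))

/-- The filter of points going to infinity inside the sector `‖z‖ ≤ C · Im z`. -/
def sectorInfty (C : ℝ) : Filter ℂ := Bornology.cobounded ℂ ⊓ Filter.principal {z | ‖z‖ ≤ C * z.im}

instance (C : ℝ) : (sectorInfty C).IsCountablyGenerated := by
  unfold sectorInfty
  rw [← comap_norm_atTop]
  infer_instance

lemma hasBasis_sectorInfty (C : ℝ) :
    (sectorInfty C).HasBasis (fun _ : ℝ => True) (fun R => {z | R ≤ ‖z‖ ∧ ‖z‖ ≤ C * z.im}) := by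
  unfold sectorInfty
  rw [← comap_norm_atTop]
  exact (Filter.atTop_basis.comap _).inf_principal _

lemma norm_div_sub_ofReal_le {C : ℝ} (hC : 0 ≤ C) {z : ℂ} (hz : ‖z‖ ≤ C * z.im) (x : ℝ) :
    ‖z / (z - x)‖ ≤ C := by
  rw [norm_div]
  refine div_le_of_le_mul₀ (norm_nonneg _) hC (hz.trans ?_)
  refine mul_le_mul_of_nonneg_left ?_ hC
  simpa using (le_abs_self _).trans (abs_im_le_norm (z - x))

lemma tendsto_div_sub_ofReal (C x : ℝ) :
    Filter.Tendsto (fun z : ℂ => z / (z - x)) (sectorInfty C) (nhds 1) := by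
  refine Filter.Tendsto.mono_left ?_ (inf_le_left : sectorInfty C ≤ Bornology.cobounded ℂ)
  have h : Filter.Tendsto (fun z : ℂ => (1 - x * z⁻¹)⁻¹) (Bornology.cobounded ℂ)
      (nhds (1 - x * 0)⁻¹) :=
    (tendsto_const_nhds.sub (Filter.tendsto_inv₀_cobounded.const_mul _)).inv₀ (by simp)
  simp only [mul_zero, sub_zero, inv_one] at h
  refine h.congr' ?_
  filter_upwards [Bornology.eventually_ne_cobounded (0 : ℂ)] with z hz
  rw [← div_eq_mul_inv, one_sub_div hz, inv_div]

lemma eventually_sectorInfty_norm_le {C : ℝ} : ∀ᶠ z in sectorInfty C, ‖z‖ ≤ C * z.im :=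
  Filter.eventually_inf_principal.2 (Filter.Eventually.of_forall fun _ h => h)

lemma tendsto_integral_div_sub (σ : Measure ℝ) [IsProbabilityMeasure σ] {C : ℝ} (hC : 0 ≤ C) :
    Filter.Tendsto (fun z : ℂ => ∫ x : ℝ, z / (z - x) ∂σ) (sectorInfty C) (nhds 1) := by
  have h := tendsto_integral_filter_of_dominated_convergence (μ := σ) (l := sectorInfty C)
    (F := fun (z : ℂ) (x : ℝ) => z / (z - x)) (f := fun _ => 1) (fun _ => C)
    (Filter.Eventually.of_forall fun z => (by fun_prop : Measurable _).aestronglyMeasurable)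
    (eventually_sectorInfty_norm_le.mono fun z hz =>
      Filter.Eventually.of_forall fun x => norm_div_sub_ofReal_le hC hz x)
    (integrable_const _)
    (Filter.Eventually.of_forall fun x => tendsto_div_sub_ofReal C x)
  simpa using h

lemma tendsto_integral_div_sub_mul_div_sub (σ : Measure ℝ) [IsProbabilityMeasure σ]
    {C : ℝ} (hC : 0 ≤ C) :
    Filter.Tendsto (fun p : ℂ × ℂ => ∫ x : ℝ, p.1 / (p.1 - x) * (p.2 / (p.2 - x)) ∂σ)
      (sectorInfty C ×ˢ sectorInfty C) (nhds 1) := by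
  have h := tendsto_integral_filter_of_dominated_convergence (μ := σ)
    (l := sectorInfty C ×ˢ sectorInfty C)
    (F := fun (p : ℂ × ℂ) (x : ℝ) => p.1 / (p.1 - x) * (p.2 / (p.2 - x)))
    (f := fun _ => 1) (fun _ => C * C)
    (Filter.Eventually.of_forall fun z => (by fun_prop : Measurable _).aestronglyMeasurable)
    ((eventually_sectorInfty_norm_le.prod_mk eventually_sectorInfty_norm_le).mono fun p hp =>
      Filter.Eventually.of_forall fun x => by
        rw [norm_mul]
        exact mul_le_mul (norm_div_sub_ofReal_le hC hp.1 x) (norm_div_sub_ofReal_le hC hp.2 x)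
          (norm_nonneg _) hC)
    (integrable_const _)
    (Filter.Eventually.of_forall fun x => by
      simpa using ((tendsto_div_sub_ofReal C x).comp Filter.tendsto_fst).mul
        ((tendsto_div_sub_ofReal C x).comp Filter.tendsto_snd))
  simpa using h

lemma integral_div_sub_eq (σ : Measure ℝ) (z : ℂ) : ∫ x : ℝ, z / (z - x) ∂σ = z * cauchyG σ z := by
  simp only [div_eq_mul_inv, cauchyG, integral_const_mul]

lemma sub_ofReal_ne_zero {z : ℂ} (hz : 0 < z.im) (x : ℝ) : z - x ≠ 0 := fun h => by
  have := congrArg Complex.im h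
  simp at this
  exact hz.ne' this

lemma integrable_inv_sub_ofReal (σ : Measure ℝ) [IsProbabilityMeasure σ] {z : ℂ} (hz : 0 < z.im) :
    Integrable (fun x : ℝ => (z - x)⁻¹) σ := by
  refine Integrable.of_bound (by fun_prop : Measurable _).aestronglyMeasurable (z.im)⁻¹
    (Filter.Eventually.of_forall fun x => ?_)
  rw [norm_inv]
  refine inv_anti₀ hz ?_
  simpa using (le_abs_self _).trans (abs_im_le_norm (z - x))

/-- The resolvent identity for the Cauchy transform. -/
lemma mul_cauchyG_sub (σ : Measure ℝ) [IsProbabilityMeasure σ]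
    {z w : ℂ} (hz : 0 < z.im) (hw : 0 < w.im) :
    z * w * (cauchyG σ w - cauchyG σ z) =
      (z - w) * ∫ x : ℝ, z / (z - x) * (w / (w - x)) ∂σ := by
  unfold cauchyG
  rw [← integral_sub (integrable_inv_sub_ofReal σ hw) (integrable_inv_sub_ofReal σ hz),
    ← integral_const_mul, ← integral_const_mul]
  congr 1
  ext x
  have h₁ := sub_ofReal_ne_zero hz x
  have h₂ := sub_ofReal_ne_zero hw x
  field_simp
  ring

lemma tendsto_Ftr_div (σ : Measure ℝ) [IsProbabilityMeasure σ] {C : ℝ} (hC : 0 ≤ C) :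
    Filter.Tendsto (fun z : ℂ => Ftr σ z / z) (sectorInfty C) (nhds 1) := by
  have h := (tendsto_integral_div_sub σ hC).inv₀ one_ne_zero
  simp only [inv_one] at h
  refine h.congr fun z => ?_
  rw [integral_div_sub_eq, mul_inv, mul_comm, Ftr, div_eq_mul_inv]

/-- Near infinity in a sector, `F_σ - id` is small relative to `z` and a contraction. -/
lemma exists_bounds_Ftr_sub_id (σ : Measure ℝ) [IsProbabilityMeasure σ]
    {C δ : ℝ} (hC : 0 < C) (hδ : 0 < δ) :
    ∃ R : ℝ, 0 < R ∧ (∀ z : ℂ, R ≤ ‖z‖ → ‖z‖ ≤ C * z.im → ‖Ftr σ z - z‖ ≤ δ * ‖z‖) ∧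
      ∀ z w : ℂ, R ≤ ‖z‖ → ‖z‖ ≤ C * z.im → R ≤ ‖w‖ → ‖w‖ ≤ C * w.im →
        ‖(Ftr σ z - z) - (Ftr σ w - w)‖ ≤ 2⁻¹ * ‖z - w‖ := by
  have hA := tendsto_integral_div_sub σ hC.le
  have hQ := (tendsto_integral_div_sub_mul_div_sub σ hC.le).div
    ((hA.comp Filter.tendsto_fst).mul (hA.comp (Filter.tendsto_snd (f := sectorInfty C))))
    (by simp)
  have e₁ := (tendsto_Ftr_div σ hC.le).eventually (Metric.closedBall_mem_nhds _ hδ)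
  have e₂ := hQ.eventually (Metric.closedBall_mem_nhds _ (by norm_num : (0 : ℝ) < 2⁻¹))
  have e₃ := hA.eventually_ne one_ne_zero
  obtain ⟨R₁, -, h₁⟩ := (hasBasis_sectorInfty C).eventually_iff.1 (e₁.and e₃)
  obtain ⟨R₂, -, h₂⟩ := (hasBasis_sectorInfty C).prod_self.eventually_iff.1 e₂
  refine ⟨max 1 (max R₁ R₂), by positivity, fun z hzR hzC => ?_, fun z w hzR hzC hwR hwC => ?_⟩
  · have hz := (h₁ ⟨(le_max_left _ _).trans ((le_max_right _ _).trans hzR), hzC⟩).1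
    have hz0 : z ≠ 0 := norm_pos_iff.1 (one_pos.trans_le ((le_max_left _ _).trans hzR))
    rw [dist_eq_norm, div_sub_one hz0, norm_div] at hz
    exact (div_le_iff₀ (norm_pos_iff.2 hz0)).1 hz
  · have hz0 : 0 < ‖z‖ := one_pos.trans_le ((le_max_left _ _).trans hzR)
    have hw0 : 0 < ‖w‖ := one_pos.trans_le ((le_max_left _ _).trans hwR)
    have hzi : 0 < z.im := pos_of_mul_pos_right (hz0.trans_le hzC) hC.le
    have hwi : 0 < w.im := pos_of_mul_pos_right (hw0.trans_le hwC) hC.le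
    have hzG := (h₁ ⟨(le_max_left _ _).trans ((le_max_right _ _).trans hzR), hzC⟩).2
    have hwG := (h₁ ⟨(le_max_left _ _).trans ((le_max_right _ _).trans hwR), hwC⟩).2
    have hq := h₂ (x := (z, w)) ⟨⟨(le_max_right _ _).trans ((le_max_right _ _).trans hzR), hzC⟩,
      ⟨(le_max_right _ _).trans ((le_max_right _ _).trans hwR), hwC⟩⟩
    have hres := mul_cauchyG_sub σ hzi hwi
    rw [integral_div_sub_eq] at hzG hwG
    simp only [dist_eq_norm, Pi.div_apply, Function.comp_apply, integral_div_sub_eq,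
      mul_one, div_one] at hq
    set P := ∫ x : ℝ, z / (z - x) * (w / (w - x)) ∂σ
    have hGz := right_ne_zero_of_mul hzG
    have hGw := right_ne_zero_of_mul hwG
    have hz' := left_ne_zero_of_mul hzG
    have hw' := left_ne_zero_of_mul hwG
    have hid : (Ftr σ z - z) - (Ftr σ w - w) =
        (P / (z * cauchyG σ z * (w * cauchyG σ w)) - 1) * (z - w) := by
      unfold Ftr
      field_simp
      linear_combination hres
    rw [hid, norm_mul]
    gcongr

/-- The image of a truncated cone under `F_σ` contains a truncated cone. -/
lemma exists_tcone_subset_image_Ftr (σ : Measure ℝ) [IsProbabilityMeasure σ]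
    {α M : ℝ} (hα : 0 < α) (hM : 0 < M) :
    ∃ β N : ℝ, 0 < β ∧ 0 < N ∧ tcone β N ⊆ Ftr σ '' tcone α M := by
  set c : ℝ := α / (2 * (1 + α)) with hc
  have hc0 : 0 < c := by positivity
  have hcα : c * (1 + α) = α / 2 := by rw [hc]; field_simp
  have hc1 : c < 2⁻¹ := by nlinarith
  obtain ⟨R, hR, hsmall, hlip⟩ := exists_bounds_Ftr_sub_id σ (C := 1 + α)
    (δ := c / (2 * (1 + α))) (by positivity) (by positivity)
  refine ⟨α / 2, 2 * max M R, by positivity, by positivity, fun w hw => ?_⟩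
  obtain ⟨hw₁, hw₂⟩ := hw
  have hwM : 2 * M < w.im := lt_of_le_of_lt (by gcongr; exact le_max_left _ _) hw₂
  have hwR : 2 * R < w.im := lt_of_le_of_lt (by gcongr; exact le_max_right _ _) hw₂
  have hball : ∀ z ∈ Metric.closedBall w (c * w.im), z ∈ tcone α M ∧ R ≤ ‖z‖ ∧
      ‖z‖ ≤ (1 + α) * z.im := by
    intro z hz
    rw [mem_closedBall_iff_norm] at hz
    have hre := abs_le.1 ((abs_re_le_norm (z - w)).trans hz)
    have him := abs_le.1 ((abs_im_le_norm (z - w)).trans hz)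
    rw [sub_re] at hre
    rw [sub_im] at him
    have hw₁' := abs_lt.1 hw₁
    have hzim : w.im * 2⁻¹ < z.im := by nlinarith
    have hzre : |z.re| < α * z.im := by
      have : α * (w.im - c * w.im) ≤ α * z.im := by gcongr; linarith
      rw [abs_lt]
      constructor <;> nlinarith
    refine ⟨⟨hzre, by linarith⟩, ?_, ?_⟩
    · exact le_trans (by linarith) ((le_abs_self _).trans (abs_im_le_norm z))
    · have := norm_le_abs_re_add_abs_im z
      rw [abs_of_pos (by linarith : 0 < z.im)] at this
      linarith
  have hr : 0 ≤ c * w.im := by nlinarith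
  have hwb := hball w (Metric.mem_closedBall_self hr)
  have hmaps : Set.MapsTo (fun z => w - (Ftr σ z - z)) (Metric.closedBall w (c * w.im))
      (Metric.closedBall w (c * w.im)) := by
    intro z hz
    have hzb := hball z hz
    rw [mem_closedBall_iff_norm] at hz ⊢
    have h₁ := hlip z w hzb.2.1 hzb.2.2 hwb.2.1 hwb.2.2
    have h₂ : ‖Ftr σ w - w‖ ≤ c * w.im / 2 := by
      refine (hsmall w hwb.2.1 hwb.2.2).trans ?_
      calc c / (2 * (1 + α)) * ‖w‖ ≤ c / (2 * (1 + α)) * ((1 + α) * w.im) := by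
            gcongr; exact hwb.2.2
        _ = c * w.im / 2 := by field_simp
    have h₃ : ‖w - (Ftr σ z - z) - w‖ = ‖Ftr σ z - z‖ := by
      rw [sub_sub_cancel_left, norm_neg]
    have h₄ := norm_sub_norm_le (Ftr σ z - z) (Ftr σ w - w)
    linarith
  have hcontr : ContractingWith 2⁻¹ (hmaps.restrict _ _ _) := by
    refine ⟨by norm_num, LipschitzWith.of_dist_le_mul fun x y => ?_⟩
    have hx := hball x x.2
    have hy := hball y y.2
    have := hlip x y hx.2.1 hx.2.2 hy.2.1 hy.2.2
    simp only [Subtype.dist_eq, Set.MapsTo.val_restrict_apply, dist_eq_norm,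
      sub_sub_sub_cancel_left]
    rw [norm_sub_rev]
    simpa using this
  obtain ⟨z, hz, hfix, -⟩ := hcontr.exists_fixedPoint' Metric.isClosed_closedBall.isComplete
    hmaps (Metric.mem_closedBall_self hr) (edist_ne_top _ _)
  refine ⟨z, (hball z hz).1, ?_⟩
  have : w - (Ftr σ z - z) = z := hfix
  linear_combination -this

lemma tcone_min_max_subset {α β M N : ℝ} (hM : 0 < M) :
    tcone (min α β) (max M N) ⊆ tcone α M ∩ tcone β N := by
  rintro z ⟨h₁, h₂⟩
  obtain ⟨hzM, hzN⟩ := max_lt_iff.1 h₂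
  have hz : 0 ≤ z.im := (hM.trans hzM).le
  exact ⟨⟨h₁.trans_le (mul_le_mul_of_nonneg_right (min_le_left _ _) hz), hzM⟩,
    ⟨h₁.trans_le (mul_le_mul_of_nonneg_right (min_le_right _ _) hz), hzN⟩⟩

/-- For `sub = μ ⊳ ν` (the subordination distribution), one has
`φ_{μ⊳ν}(z) = φ_μ(F_ν(z))` on a common truncated cone; moreover if `μ ⊳ ν` is
⊞-infinitely divisible and `Φ[μ,ν] = B⁻¹[μ ⊳ ν]`, then `z − F_{Φ[μ,ν]}(z) = φ_μ(F_ν(z))`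
and `φ_μ` is the two-state Voiculescu transform of the pair `(Φ[μ,ν], ν)`. -/
theorem stmt1
    (μ ν : Measure ℝ) (hμ : IsProbabilityMeasure μ) (hν : IsProbabilityMeasure ν)
    (φμ φν : ℂ → ℂ) (hφμ : IsVT μ φμ) (hφν : IsVT ν φν)
    (mconv : Measure ℝ) (hconvprob : IsProbabilityMeasure mconv)
    (hconv : IsVT mconv (fun z => φμ z + φν z))
    (sub : Measure ℝ) (hsubprob : IsProbabilityMeasure sub)
    (hsub : ∀ z ∈ UHP, cauchyG mconv z = cauchyG ν (Ftr sub z))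
    (φs : ℂ → ℂ) (hφs : IsVT sub φs) :
    (∃ α M : ℝ, 0 < α ∧ 0 < M ∧ ∀ z ∈ tcone α M, φs z = φμ (Ftr ν z)) ∧
    (IsFID sub →
      ∀ Phimn : Measure ℝ, IsProbabilityMeasure Phimn →
        IsVT sub (fun z => z - Ftr Phimn z) →
        (∃ α M : ℝ, 0 < α ∧ 0 < M ∧ ∀ z ∈ tcone α M,
          z - Ftr Phimn z = φμ (Ftr ν z)) ∧ IsTwoStateVT Phimn ν φμ) := by
  have key : ∀ φ : ℂ → ℂ, IsVT sub φ →
      ∃ α M : ℝ, 0 < α ∧ 0 < M ∧ ∀ z ∈ tcone α M, φ z = φμ (Ftr ν z) := by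
    rintro φ ⟨α₁, M₁, hα₁, hM₁, h₁⟩
    obtain ⟨α₂, M₂, hα₂, hM₂, h₂⟩ := hconv
    obtain ⟨α₃, M₃, hα₃, hM₃, h₃⟩ := hφν
    obtain ⟨β, N, hβ, hN, himg⟩ := exists_tcone_subset_image_Ftr sub
      (lt_min hα₁ hα₂) (lt_max_of_lt_left (b := M₁) (c := M₂) hM₁)
    refine ⟨min β α₃, max N M₃, lt_min hβ hα₃, lt_max_of_lt_left hN, fun w hw => ?_⟩
    obtain ⟨hwN, hwν⟩ := tcone_min_max_subset hN hw
    obtain ⟨z, hz, rfl⟩ := himg hwN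
    obtain ⟨hz₁, hz₂⟩ := tcone_min_max_subset hM₁ hz
    have hF : Ftr mconv z = Ftr ν (Ftr sub z) := by
      rw [Ftr, hsub z (hM₁.trans hz₁.2)]
      rfl
    have e₁ := h₁ z hz₁
    have e₂ := h₂ z hz₂
    have e₃ := h₃ _ hwν
    simp only [hF] at e₂
    linear_combination e₁ - e₂ + e₃
  refine ⟨key φs hφs, fun _ Phimn _ hΦ => ?_⟩
  obtain ⟨α, M, hα, hM, h⟩ := key _ hΦ
  refine ⟨⟨α, M, hα, hM, h⟩, α, M, hα, hM, fun z hz => ?_⟩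
  rw [← h z hz, sub_add_cancel]
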